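/- Let G be a profinite group and U a pseudocompact k⟦G⟧-module. Then U/Soc(U) is isomorphic to the inverse limit, over open normal subgroups N of G, of the quotients U_N/Soc(U_N). -/

import Mathlib

open scoped Classical
set_option maxHeartbeats 1000000
set_option synthInstance.maxHeartbeats 400000

noncomputable section

namespace ProfiniteBlocks

variable (k : Type) [Field k] (G : Type) [Group G] [TopologicalSpace G]

/-- Discrete topology on each finite level group algebra. -/
instance (X : Type) : TopologicalSpace (MonoidAlgebra k X) := ⊥

/-- The canonical quotient homomorphism `G/N → G/M` for `N ≤ M`. -/
def qHom (N M : OpenNormalSubgroup G) (h : N ≤ M) :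
    G ⧸ N.toSubgroup →* G ⧸ M.toSubgroup :=
  QuotientGroup.map _ _ (MonoidHom.id G) (fun x hx => h hx)

/-- The induced algebra homomorphism `k[G/N] → k[G/M]` for `N ≤ M`. -/
def tHom (N M : OpenNormalSubgroup G) (h : N ≤ M) :
    MonoidAlgebra k (G ⧸ N.toSubgroup) →ₐ[k] MonoidAlgebra k (G ⧸ M.toSubgroup) :=
  MonoidAlgebra.mapDomainAlgHom k k (qHom G N M h)

/-- The completed group algebra `k⟦G⟧`, realized as the inverse limit of the finite
level group algebras `k[G/N]` over all open normal subgroups `N` of `G`, sitting inside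
their product. -/
def CGA : Subalgebra k (∀ N : OpenNormalSubgroup G, MonoidAlgebra k (G ⧸ N.toSubgroup)) where
  carrier := {x | ∀ (N M : OpenNormalSubgroup G) (h : N ≤ M), tHom k G N M h (x N) = x M}
  add_mem' hx hy N M h := by simp [map_add, hx N M h, hy N M h]
  mul_mem' hx hy N M h := by simp [map_mul, hx N M h, hy N M h]
  algebraMap_mem' r N M h := by
    simp [tHom, MonoidAlgebra.mapDomainAlgHom, MonoidAlgebra.mapDomainRingHom,
      Finsupp.mapDomain_single]

instance : Ring (CGA k G) := inferInstance
instance : Algebra k (CGA k G) := inferInstance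

/-- `k⟦G⟧` carries the inverse limit topology (each `k[G/N]` being discrete). -/
instance : TopologicalSpace (CGA k G) := inferInstanceAs (TopologicalSpace (Subtype _))

/-- The canonical (continuous) inclusion of `G` into `k⟦G⟧`. -/
def ofG : G →* CGA k G where
  toFun g := ⟨fun N => MonoidAlgebra.single ((g : G) : G ⧸ N.toSubgroup) 1, by
    intro N M h
    simp [tHom, MonoidAlgebra.mapDomainAlgHom, MonoidAlgebra.mapDomainRingHom,
      Finsupp.mapDomain_single, qHom, QuotientGroup.map_mk]
    rfl⟩
  map_one' := by
    ext N
    simp [MonoidAlgebra.one_def]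
  map_mul' g g' := by
    ext N
    simp [MonoidAlgebra.single_mul_single]


/-- The map between quotient modules induced by `f` (the canonical map whenever
`f` carries `P` into `Q`). -/
def mapQ' {R X Y : Type} [Ring R] [AddCommGroup X] [AddCommGroup Y] [Module R X]
    [Module R Y] (P : Submodule R X) (Q : Submodule R Y) (f : X →ₗ[R] Y) :
    (X ⧸ P) →ₗ[R] (Y ⧸ Q) :=
  if h : P ≤ Q.comap f then Submodule.mapQ P Q f h else 0

/-- The map between submodules induced by `f` (the canonical restriction whenever
`f` carries `P` into `Q`). -/
def restrict' {R X Y : Type} [Ring R] [AddCommGroup X] [AddCommGroup Y] [Module R X]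
    [Module R Y] (P : Submodule R X) (Q : Submodule R Y) (f : X →ₗ[R] Y) :
    P →ₗ[R] Q :=
  if h : ∀ x ∈ P, f x ∈ Q then f.restrict h else 0

/-- The subquotient `W / W'` of a module. -/
abbrev subQuot {R X : Type} [Ring R] [AddCommGroup X] [Module R X]
    (W W' : Submodule R X) : Type :=
  W ⧸ (W'.comap W.subtype)

/-- The radical of a topological module: the intersection of its maximal open
submodules. -/
def radical (R : Type) [Ring R] (X : Type) [AddCommGroup X] [Module R X]
    [TopologicalSpace X] : Submodule R X :=
  sInf {W : Submodule R X | IsCoatom W ∧ IsOpen (W : Set X)}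

/-- Iterated radicals `Rad^i(X)`, with `Rad^0(X) = X`. -/
def radPow (R : Type) [Ring R] (X : Type) [AddCommGroup X] [Module R X]
    [TopologicalSpace X] : ℕ → Submodule R X
  | 0 => ⊤
  | (n + 1) => (radical R (radPow R X n)).map (radPow R X n).subtype

/-- A topological module is semisimple if every closed submodule has a closed
complement. -/
def IsSemisimpleTop (R : Type) [Ring R] (X : Type) [AddCommGroup X] [Module R X]
    [TopologicalSpace X] : Prop :=
  ∀ W : Submodule R X, IsClosed (W : Set X) →
    ∃ W' : Submodule R X, IsClosed (W' : Set X) ∧ IsCompl W W'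

/-- The socle of a topological module: the largest closed semisimple submodule
(defined as the join of all closed semisimple submodules). -/
def socle (R : Type) [Ring R] (X : Type) [AddCommGroup X] [Module R X]
    [TopologicalSpace X] : Submodule R X :=
  sSup {W : Submodule R X | IsClosed (W : Set X) ∧ IsSemisimpleTop R W}

/-- A module is uniserial if its submodules form a chain. -/
def Uniserial (R : Type) [Ring R] (X : Type) [AddCommGroup X] [Module R X] : Prop :=
  ∀ W W' : Submodule R X, W ≤ W' ∨ W' ≤ W

/-- A topological module is (topologically) indecomposable if it is non-zero and
admits no non-trivial decomposition into closed direct summands. -/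
def IsIndecTop (R : Type) [Ring R] (X : Type) [AddCommGroup X] [Module R X]
    [TopologicalSpace X] : Prop :=
  Nontrivial X ∧ ∀ W W' : Submodule R X, IsClosed (W : Set X) → IsClosed (W' : Set X) →
    IsCompl W W' → W = ⊥ ∨ W' = ⊥

/-- The inverse limit of a compatible system of modules indexed by a preorder,
realized as the submodule of compatible families in the product. -/
def compatLim {ι : Type} [Preorder ι] {R : Type} [Ring R] (T : ι → Type)
    [∀ i, AddCommGroup (T i)] [∀ i, Module R (T i)]
    (t : ∀ i j, i ≤ j → (T i →ₗ[R] T j)) : Submodule R (∀ i, T i) where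
  carrier := {f | ∀ (i j : ι) (h : i ≤ j), t i j h (f i) = f j}
  add_mem' ha hb i j h := by simp only [Pi.add_apply, map_add]; rw [ha i j h, hb i j h]
  zero_mem' i j h := by simp
  smul_mem' c a ha i j h := by simp only [Pi.smul_apply, map_smul]; rw [ha i j h]

/-- `X` has exactly `n` composition factors (measured along the radical series). -/
def HasNFactors (R : Type) [Ring R] (X : Type) [AddCommGroup X] [Module R X]
    [TopologicalSpace X] (n : ℕ) : Prop :=
  radPow R X n = ⊥ ∧ ∀ m < n, radPow R X m ≠ ⊥

/-- `X` has infinitely many composition factors. -/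
def HasInfFactors (R : Type) [Ring R] (X : Type) [AddCommGroup X] [Module R X]
    [TopologicalSpace X] : Prop :=
  ∀ n : ℕ, radPow R X n ≠ ⊥



section Coinvariants

variable {k : Type} [Field k] {G : Type} [Group G] [TopologicalSpace G]

variable (k G) in
/-- The (closed) submodule `I_N U` of a topological `k⟦G⟧`-module `U`: the smallest
closed submodule containing all elements `n • u - u` for `n ∈ N`.  Its quotient is the
module of `N`-coinvariants. -/
def coinvKer (N : OpenNormalSubgroup G) (U : Type) [AddCommGroup U]
    [Module (CGA k G) U] [TopologicalSpace U] : Submodule (CGA k G) U :=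
  sInf {W : Submodule (CGA k G) U | IsClosed (W : Set U) ∧
    ∀ n ∈ N.toSubgroup, ∀ u : U, ofG k G n • u - u ∈ W}

variable (k G) in
/-- The module of `N`-coinvariants `U_N` of a topological `k⟦G⟧`-module `U`. -/
abbrev coinv (N : OpenNormalSubgroup G) (U : Type) [AddCommGroup U]
    [Module (CGA k G) U] [TopologicalSpace U] : Type :=
  U ⧸ coinvKer k G N U

variable (k G) in
/-- The canonical projection `φ_N : U → U_N`. -/
def phi (N : OpenNormalSubgroup G) (U : Type) [AddCommGroup U]
    [Module (CGA k G) U] [TopologicalSpace U] : U →ₗ[CGA k G] coinv k G N U :=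
  (coinvKer k G N U).mkQ

lemma coinvKer_mono {N M : OpenNormalSubgroup G} (h : N ≤ M) (U : Type) [AddCommGroup U]
    [Module (CGA k G) U] [TopologicalSpace U] : coinvKer k G N U ≤ coinvKer k G M U :=
  sInf_le_sInf (fun W hW => ⟨hW.1, fun n hn u => hW.2 n (h hn) u⟩)

variable (k G) in
/-- The canonical projection `φ_{MN} : U_N → U_M` for `N ≤ M`. -/
def phiT (N M : OpenNormalSubgroup G) (h : N ≤ M) (U : Type) [AddCommGroup U]
    [Module (CGA k G) U] [TopologicalSpace U] :
    coinv k G N U →ₗ[CGA k G] coinv k G M U :=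
  Submodule.mapQ _ _ LinearMap.id (fun _ hx => coinvKer_mono h U hx)

variable (k G) in
/-- `N` acts trivially on the `k⟦G⟧`-module `W`. -/
def NTrivial (N : OpenNormalSubgroup G) (W : Type) [AddCommGroup W]
    [Module (CGA k G) W] : Prop :=
  ∀ n ∈ N.toSubgroup, ∀ w : W, ofG k G n • w = w

end Coinvariants

section Pseudocompact

variable (k : Type) [Field k]

/-- A pseudocompact module over a topological `k`-algebra `A`: a Hausdorff topological
module possessing a basis of neighbourhoods of `0` consisting of open submodules of
finite codimension which intersect in `0`, and which is the inverse limit of the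
corresponding discrete quotients. -/
structure IsPseudocompactMod (A : Type) [Ring A] [Algebra k A] [TopologicalSpace A]
    (X : Type) [AddCommGroup X] [Module k X] [Module A X] [IsScalarTower k A X]
    [TopologicalSpace X] : Prop where
  t2 : T2Space X
  addGroup : IsTopologicalAddGroup X
  contSMul : ContinuousSMul A X
  basis : (nhds (0 : X)).HasBasis
    (fun V : Submodule A X => IsOpen (V : Set X) ∧
      FiniteDimensional k (X ⧸ V.restrictScalars k))
    (fun V => (V : Set X))
  inf_bot : (⨅ (V : Submodule A X) (_ : IsOpen (V : Set X) ∧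
      FiniteDimensional k (X ⧸ V.restrictScalars k)), V) = ⊥
  complete : ∀ c : ∀ V : {V : Submodule A X // IsOpen (V : Set X) ∧
      FiniteDimensional k (X ⧸ V.restrictScalars k)}, X ⧸ V.1,
    (∀ (V W : {V : Submodule A X // IsOpen (V : Set X) ∧
        FiniteDimensional k (X ⧸ V.restrictScalars k)}), V.1 ≤ W.1 →
      mapQ' V.1 W.1 LinearMap.id (c V) = c W) →
    ∃ x : X, ∀ V, c V = Submodule.Quotient.mk x

end Pseudocompact

section Blocks

variable (R : Type) [Ring R]

/-- A block idempotent: a centrally primitive idempotent of `R`. -/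
structure IsBlockIdem (e : R) : Prop where
  idem : IsIdempotentElem e
  ne_zero : e ≠ 0
  central : e ∈ Set.center R
  primitive : ∀ f g : R, f ∈ Set.center R → g ∈ Set.center R → IsIdempotentElem f →
    IsIdempotentElem g → f * g = 0 → g * f = 0 → e = f + g → f = 0 ∨ g = 0

/-- The block `B = Re` determined by a central idempotent `e`, as a left `R`-module. -/
def blockMod (e : R) (he : e ∈ Set.center R) : Submodule R R where
  carrier := {a : R | a * e = a}
  add_mem' := by intro a b ha hb; simp only [Set.mem_setOf_eq, add_mul] at *; rw [ha, hb]
  zero_mem' := by simp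
  smul_mem' := by
    intro c a ha
    simp only [Set.mem_setOf_eq, smul_eq_mul, mul_assoc] at *
    rw [ha]

/-- A module belongs to the block of the central idempotent `e` if `e` acts as the
identity on it. -/
def InBlock {X : Type} [AddCommGroup X] [Module R X] (e : R) : Prop :=
  ∀ x : X, e • x = x

end Blocks

section Defect

variable {k : Type} [Field k] {G : Type} [Group G] [TopologicalSpace G]

variable (k G) in
/-- The conjugation action of `G` on `k⟦G⟧`. -/
def conjAct (g : G) (x : CGA k G) : CGA k G :=
  ofG k G g * x * ofG k G g⁻¹

variable (k G) in
/-- The `H`-fixed points of `k⟦G⟧` under conjugation. -/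
def fixedBy (H : Subgroup G) : Set (CGA k G) :=
  {x : CGA k G | ∀ h ∈ H, conjAct k G h x = x}

variable (k G) in
/-- The relative trace map `Tr_H^G` on `k⟦G⟧` (a finite sum over coset
representatives when `H` is open). -/
def trMap (H : Subgroup G) (x : CGA k G) : CGA k G :=
  ∑ᶠ c : G ⧸ H, conjAct k G (Quotient.out c) x

variable (k G) in
/-- The image `Tr_H^G(k⟦G⟧^H)`. -/
def trImage (H : Subgroup G) : Set (CGA k G) :=
  trMap k G H '' fixedBy k G H

variable (k G) in
/-- `D` satisfies the defect property for `e`: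
`e ∈ ⋂_N Tr_{DN}^G (k⟦G⟧^{DN})`. -/
def DefectProp (e : CGA k G) (D : Subgroup G) : Prop :=
  ∀ N : OpenNormalSubgroup G, e ∈ trImage k G (D ⊔ N.toSubgroup)

variable (k G) in
/-- `D` is a defect group of the block of `e`: a closed subgroup, minimal subject to
the defect property. -/
structure IsDefectGroup (e : CGA k G) (D : Subgroup G) : Prop where
  closed : IsClosed (D : Set G)
  defect : DefectProp k G e D
  minimal : ∀ D' : Subgroup G, IsClosed ((D' : Set G)) → D' ≤ D →
    DefectProp k G e D' → D' = D

end Defect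

section FiniteDefect

variable (k : Type) [Field k] (Q : Type) [Group Q]

/-- Conjugation on a finite level group algebra `k[Q]`. -/
def conjActF (q : Q) (x : MonoidAlgebra k Q) : MonoidAlgebra k Q :=
  MonoidAlgebra.single q 1 * x * MonoidAlgebra.single q⁻¹ 1

/-- `H`-fixed points of `k[Q]` under conjugation. -/
def fixedByF (H : Subgroup Q) : Set (MonoidAlgebra k Q) :=
  {x | ∀ h ∈ H, conjActF k Q h x = x}

/-- The relative trace map `Tr_H^Q` on `k[Q]`. -/
def trMapF (H : Subgroup Q) (x : MonoidAlgebra k Q) : MonoidAlgebra k Q :=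
  ∑ᶠ c : Q ⧸ H, conjActF k Q (Quotient.out c) x

/-- The image `Tr_H^Q(k[Q]^H)`. -/
def trImageF (H : Subgroup Q) : Set (MonoidAlgebra k Q) :=
  trMapF k Q H '' fixedByF k Q H

/-- `Dq` is a defect group of the block of `e` in the group algebra `k[Q]`. -/
structure IsDefectGroupF (e : MonoidAlgebra k Q) (Dq : Subgroup Q) : Prop where
  defect : e ∈ trImageF k Q Dq
  minimal : ∀ D' : Subgroup Q, D' ≤ Dq → e ∈ trImageF k Q D' → D' = Dq

end FiniteDefect

section CyclicDefect

variable {k : Type} [Field k] {G : Type} [Group G] [TopologicalSpace G]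

variable (G) in
/-- A subgroup is procyclic if it possesses a dense cyclic (abstract) subgroup. -/
def IsProcyclic (D : Subgroup G) : Prop :=
  ∃ g : G, closure ((Subgroup.zpowers g : Subgroup G) : Set G) = (D : Set G)

variable (G) in
/-- `D` is isomorphic, as a topological group, to the `p`-adic integers `ℤ_p`. -/
def IsZpGroup (p : ℕ) [Fact p.Prime] (D : Subgroup G) : Prop :=
  ∃ φ : D ≃ₜ Multiplicative ℤ_[p], ∀ x y : D, φ (x * y) = φ x * φ y

variable (G) in
/-- `D` is a cyclic pro-`p` group: either a finite cyclic `p`-group or `ℤ_p`. -/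
def IsCyclicProP (p : ℕ) [Fact p.Prime] (D : Subgroup G) : Prop :=
  (Finite D ∧ IsPGroup p D ∧ IsCyclic D) ∨ IsZpGroup G p D

end CyclicDefect

section Simples

variable {k : Type} [Field k] {G : Type} [Group G] [TopologicalSpace G]

variable (k G) in
/-- The projection `k⟦G⟧ → k[G/N]`. -/
def projN (N : OpenNormalSubgroup G) (x : CGA k G) :
    MonoidAlgebra k (G ⧸ N.toSubgroup) :=
  (x : ∀ N : OpenNormalSubgroup G, MonoidAlgebra k (G ⧸ N.toSubgroup)) N

variable (k G) in
/-- `N` acts trivially on every simple module of the block of `e`. -/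
def TrivOnSimples (e : CGA k G) (N : OpenNormalSubgroup G) : Prop :=
  ∀ (S : Type) [AddCommGroup S] [Module (CGA k G) S],
    IsSimpleModule (CGA k G) S → InBlock (CGA k G) (X := S) e → NTrivial k G N S

variable (k G) in
/-- Membership of `N` in the standard cofinal system `𝒩` for the block `B` of `e`
with defect group `D`: the coinvariant algebra `B_N` is a block of `k[G/N]` with
defect group `DN/N`, and `N` acts trivially on every simple `B`-module. -/
structure GoodN (e : CGA k G) (D : Subgroup G) (N : OpenNormalSubgroup G) : Prop where
  blockN : IsBlockIdem (MonoidAlgebra k (G ⧸ N.toSubgroup)) (projN k G N e)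
  defectN : IsDefectGroupF k (G ⧸ N.toSubgroup) (projN k G N e)
    (D.map (QuotientGroup.mk' N.toSubgroup))
  triv : TrivOnSimples k G e N

/-- A cofinal set of open normal subgroups. -/
def IsCofinal {G : Type} [Group G] [TopologicalSpace G]
    (𝒩 : Set (OpenNormalSubgroup G)) : Prop :=
  ∀ M : OpenNormalSubgroup G, ∃ N ∈ 𝒩, N ≤ M

variable (k G) in
/-- A pseudocompact module is pro-uniserial (w.r.t. the cofinal system `𝒩`) if all
its coinvariant quotients at members of `𝒩` are uniserial. -/
def ProUniserial (𝒩 : Set (OpenNormalSubgroup G)) (U : Type) [AddCommGroup U]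
    [Module (CGA k G) U] [TopologicalSpace U] : Prop :=
  ∀ N ∈ 𝒩, Uniserial (CGA k G) (coinv k G N U)

variable (k G) in
/-- `S` is a composition factor of the pseudocompact module `U`: it is a composition
factor of some finite coinvariant quotient `U_N`. -/
def IsCompFactorOf (U : Type) [AddCommGroup U] [Module (CGA k G) U]
    [TopologicalSpace U] (S : Type) [AddCommGroup S] [Module (CGA k G) S] : Prop :=
  ∃ (N : OpenNormalSubgroup G) (W W' : Submodule (CGA k G) (coinv k G N U)),
    W' ≤ W ∧ Nonempty (subQuot W W' ≃ₗ[CGA k G] S)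

variable (k G) in
/-- `S` is a composition factor of the finite-dimensional module `X`. -/
def IsCompFactorFin (X : Type) [AddCommGroup X] [Module (CGA k G) X]
    (S : Type) [AddCommGroup S] [Module (CGA k G) S] : Prop :=
  ∃ W W' : Submodule (CGA k G) X, W' ≤ W ∧ Nonempty (subQuot W W' ≃ₗ[CGA k G] S)

end Simples

section Projective

variable {k : Type} [Field k] {G : Type} [Group G] [TopologicalSpace G]

variable (k G) in
/-- A pseudocompact `k⟦G⟧`-module is (categorically) projective if every continuous
surjection onto it from a pseudocompact module splits. -/
def IsPCProjective (P : Type) [AddCommGroup P] [Module (CGA k G) P]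
    [TopologicalSpace P] : Prop :=
  ∀ (W : Type) [AddCommGroup W] [Module k W] [Module (CGA k G) W]
    [IsScalarTower k (CGA k G) W] [TopologicalSpace W],
    IsPseudocompactMod k (CGA k G) W →
    ∀ f : W →ₗ[CGA k G] P, Continuous f → Function.Surjective f →
      ∃ s : P →ₗ[CGA k G] W, Continuous s ∧ f.comp s = LinearMap.id

variable (k G) in
/-- `P` is a projective cover of the simple module `S` in the block of `e`:
a pseudocompact projective module of the block together with a surjection onto `S`
whose kernel is superfluous (contained in the radical). -/
structure IsProjCover (e : CGA k G) (P : Type) [AddCommGroup P] [Module k P]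
    [Module (CGA k G) P] [IsScalarTower k (CGA k G) P] [TopologicalSpace P]
    (S : Type) [AddCommGroup S] [Module (CGA k G) S] : Prop where
  pseudocompact : IsPseudocompactMod k (CGA k G) P
  inBlock : InBlock (CGA k G) (X := P) e
  projective : IsPCProjective k G P
  cover : ∃ π : P →ₗ[CGA k G] S, Function.Surjective π ∧
    LinearMap.ker π ≤ radical (CGA k G) P

end Projective




/-- The map between subquotients induced by `f`. -/
def subQuotMap {R X Y : Type} [Ring R] [AddCommGroup X] [AddCommGroup Y] [Module R X]
    [Module R Y] (W W' : Submodule R X) (V V' : Submodule R Y) (f : X →ₗ[R] Y) :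
    subQuot W W' →ₗ[R] subQuot V V' :=
  mapQ' (W'.comap W.subtype) (V'.comap V.subtype) (restrict' W V f)

/-- The conditions of Proposition 3.8 on a pair of pro-uniserial submodules `X`, `Y`
of an indecomposable projective `P`: `X ∩ Y = Soc(P)`, `X + Y = Rad(P)`, and
`Rad(P)/Soc(P) ≅ X/Soc(P) ⊕ Y/Soc(P)` with no common composition factors. -/
def ProUniserialPair (k : Type) [Field k] (G : Type) [Group G] [TopologicalSpace G]
    (𝒩 : Set (OpenNormalSubgroup G)) (P : Type) [AddCommGroup P]
    [Module (CGA k G) P] [TopologicalSpace P]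
    (X Y : Submodule (CGA k G) P) : Prop :=
  ProUniserial k G 𝒩 X ∧ ProUniserial k G 𝒩 Y ∧
  X ⊓ Y = socle (CGA k G) P ∧
  X ⊔ Y = radical (CGA k G) P ∧
  Nonempty ((subQuot (radical (CGA k G) P) (socle (CGA k G) P)) ≃ₗ[CGA k G]
    (subQuot X (socle (CGA k G) P) × subQuot Y (socle (CGA k G) P))) ∧
  ∀ (T : Type) [AddCommGroup T] [Module (CGA k G) T], IsSimpleModule (CGA k G) T →
    ¬ (IsCompFactorOf k G (subQuot X (socle (CGA k G) P)) T ∧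
       IsCompFactorOf k G (subQuot Y (socle (CGA k G) P)) T)

/-- `S : ι → Type` is a complete set of pairwise non-isomorphic representatives of
the simple modules of the block of `e`. -/
def IsSimpleReps (k : Type) [Field k] (G : Type) [Group G] [TopologicalSpace G]
    (e : CGA k G) {ι : Type} (S : ι → Type) [∀ i, AddCommGroup (S i)]
    [∀ i, Module (CGA k G) (S i)] : Prop :=
  (∀ i, IsSimpleModule (CGA k G) (S i) ∧ InBlock (CGA k G) (X := S i) e) ∧
  (∀ i j, i ≠ j → IsEmpty (S i ≃ₗ[CGA k G] S j)) ∧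
  (∀ (T : Type) [AddCommGroup T] [Module (CGA k G) T],
    IsSimpleModule (CGA k G) T → InBlock (CGA k G) (X := T) e →
      ∃ i, Nonempty (T ≃ₗ[CGA k G] S i))

section Brauer

/-- The size of the `ρ`-orbit of `i` (the number of edges at the corresponding vertex
of the Brauer tree). -/
def orbSize {ι : Type} (ρ : Equiv.Perm ι) (i : ι) : ℕ :=
  Function.minimalPeriod ρ i

/-- Data describing the exceptional vertex of a Brauer tree: `none` if there is no
exceptional vertex, and otherwise a flag recording whether it is a `ρ`-vertex or a
`σ`-vertex together with an edge adjacent to it. -/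
abbrev ExcVertex (ι : Type) : Type := Option (Bool × ι)

/-- The edge `i` is adjacent to the exceptional vertex, its `ρ`-endpoint being
exceptional. -/
def AdjExcRho {ι : Type} (ρ : Equiv.Perm ι) (exc : ExcVertex ι) (i : ι) : Prop :=
  ∃ j : ι, exc = some (true, j) ∧ ρ.SameCycle j i

/-- The edge `i` is adjacent to the exceptional vertex, its `σ`-endpoint being
exceptional. -/
def AdjExcSigma {ι : Type} (σ : Equiv.Perm ι) (exc : ExcVertex ι) (i : ι) : Prop :=
  ∃ j : ι, exc = some (false, j) ∧ σ.SameCycle j i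

/-- The edge `i` is adjacent to the exceptional vertex. -/
def AdjExc {ι : Type} (ρ σ : Equiv.Perm ι) (exc : ExcVertex ι) (i : ι) : Prop :=
  AdjExcRho ρ exc i ∨ AdjExcSigma σ exc i

end Brauer


section LinearlyCompact

variable {R : Type} [Ring R]

/-- The algebraic socle: the join of all semisimple submodules. -/
def algSocle (R : Type) [Ring R] (X : Type) [AddCommGroup X] [Module R X] : Submodule R X :=
  sSup {W : Submodule R X | IsSemisimpleModule R W}

lemma isSemisimpleModule_algSocle (X : Type) [AddCommGroup X] [Module R X] :
    IsSemisimpleModule R (algSocle R X) := by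
  rw [algSocle, sSup_eq_iSup]
  exact isSemisimpleModule_biSup_of_isSemisimpleModule_submodule (fun _ hW => hW)

lemma le_algSocle {X : Type} [AddCommGroup X] [Module R X] {W : Submodule R X}
    (hW : IsSemisimpleModule R W) : W ≤ algSocle R X :=
  le_sSup hW

lemma isSemisimpleModule_of_le_algSocle {X : Type} [AddCommGroup X] [Module R X]
    {W : Submodule R X} (hW : W ≤ algSocle R X) : IsSemisimpleModule R W :=
  have := isSemisimpleModule_algSocle (R := R) X
  IsSemisimpleModule.of_injective (Submodule.inclusion hW) (Submodule.inclusion_injective hW)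

lemma map_mem_algSocle {X Y : Type} [AddCommGroup X] [Module R X] [AddCommGroup Y] [Module R Y]
    (f : X →ₗ[R] Y) {x : X} (hx : x ∈ algSocle R X) : f x ∈ algSocle R Y := by
  have := isSemisimpleModule_algSocle (R := R) X
  refine le_algSocle (IsSemisimpleModule.range (f ∘ₗ (algSocle R X).subtype)) ?_
  exact ⟨⟨x, hx⟩, rfl⟩

/-- Linearly topologized Hausdorff modules that are linearly compact (families of cosets of
closed submodules with the finite intersection property have a common point) and whose discrete
quotients are artinian. -/
structure IsLinearlyCompactMod (R : Type) [Ring R] (X : Type) [AddCommGroup X] [Module R X]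
    [TopologicalSpace X] : Prop where
  t2 : T2Space X
  addGroup : IsTopologicalAddGroup X
  basis : (nhds (0 : X)).HasBasis (fun V : Submodule R X => IsOpen (V : Set X))
    (fun V => (V : Set X))
  artinian : ∀ V : Submodule R X, IsOpen (V : Set X) → IsArtinian R (X ⧸ V)
  exists_common : ∀ {ι : Type} (a : ι → X) (C : ι → Submodule R X),
    (∀ i, IsClosed (C i : Set X)) → (∀ s : Finset ι, ∃ x, ∀ i ∈ s, x - a i ∈ C i) →
    ∃ x, ∀ i, x - a i ∈ C i

variable {X : Type} [AddCommGroup X] [Module R X] [TopologicalSpace X]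

lemma isClosed_of_isOpen_submodule [IsTopologicalAddGroup X] {V : Submodule R X}
    (hV : IsOpen (V : Set X)) : IsClosed (V : Set X) :=
  V.toAddSubgroup.isClosed_of_isOpen hV

lemma isOpen_of_isOpen_le [IsTopologicalAddGroup X] {V W : Submodule R X}
    (hV : IsOpen (V : Set X)) (hVW : V ≤ W) : IsOpen (W : Set X) :=
  AddSubgroup.isOpen_mono (H₁ := V.toAddSubgroup) (H₂ := W.toAddSubgroup) hVW hV

lemma isOpen_comap_mkQ [IsTopologicalAddGroup X] {V : Submodule R X}
    (hV : IsOpen (V : Set X)) (Q : Submodule R (X ⧸ V)) :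
    IsOpen (Q.comap V.mkQ : Set X) :=
  isOpen_of_isOpen_le hV (V.ker_mkQ.symm.le.trans (LinearMap.ker_le_comap _))

namespace IsLinearlyCompactMod

lemma mem_of_forall_isOpen (hX : IsLinearlyCompactMod R X) {C : Submodule R X}
    (hC : IsClosed (C : Set X)) {x : X}
    (h : ∀ V : Submodule R X, IsOpen (V : Set X) → ∃ y ∈ C, y - x ∈ V) : x ∈ C := by
  have := hX.addGroup
  rw [← SetLike.mem_coe, ← hC.closure_eq, mem_closure_iff_nhds]
  intro t ht
  have ht' : (fun y => x + y) ⁻¹' t ∈ nhds (0 : X) := by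
    refine (continuous_const_add x).continuousAt.preimage_mem_nhds ?_
    simpa using ht
  obtain ⟨V, hV, hVt⟩ := hX.basis.mem_iff.1 ht'
  obtain ⟨y, hy, hyV⟩ := h V hV
  refine ⟨y, ?_, hy⟩
  simpa using hVt hyV

lemma mem_sup_iInf (hX : IsLinearlyCompactMod R X) {ι : Type} [Nonempty ι]
    {D : ι → Submodule R X} (hD : ∀ i, IsClosed (D i : Set X)) (hdir : Directed (· ≥ ·) D)
    {C : Submodule R X} (hC : IsClosed (C : Set X)) {x : X} (hx : ∀ i, x ∈ C ⊔ D i) :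
    x ∈ C ⊔ ⨅ i, D i := by
  obtain ⟨y, hy⟩ := hX.exists_common (ι := Option ι) (fun o => o.elim 0 fun _ => x)
    (fun o => o.elim C D) (by rintro (_ | i); exacts [hC, hD i]) (by
      intro s
      obtain ⟨j, hj⟩ := hdir.finset_le s.eraseNone
      obtain ⟨c, hc, d, hd, rfl⟩ := Submodule.mem_sup.1 (hx j)
      refine ⟨c, ?_⟩
      rintro (_ | i) hi
      · simpa using hc
      · have := hj i (by simpa using hi) hd
        simpa using neg_mem this)
  have h0 : y ∈ C := by simpa using hy none
  refine Submodule.mem_sup.2 ⟨y, h0, x - y, ?_, by abel⟩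
  refine (Submodule.mem_iInf _).2 fun i => ?_
  have := neg_mem (hy (some i))
  simpa using this

lemma quotient (hX : IsLinearlyCompactMod R X) {C : Submodule R X} (hC : IsClosed (C : Set X)) :
    IsLinearlyCompactMod R (X ⧸ C) := by
  have := hX.addGroup
  have := hC
  have hcont : Continuous C.mkQ := C.isOpenQuotientMap_mkQ.continuous
  refine ⟨inferInstance, inferInstance, ?_, ?_, ?_⟩
  · refine ⟨fun t => ⟨fun ht => ?_, ?_⟩⟩
    · have : C.mkQ ⁻¹' t ∈ nhds (0 : X) :=
        hcont.continuousAt.preimage_mem_nhds (by simpa using ht)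
      obtain ⟨V, hV, hVt⟩ := hX.basis.mem_iff.1 this
      refine ⟨V.map C.mkQ, ?_, ?_⟩
      · rw [Submodule.map_coe]
        exact C.isOpenMap_mkQ _ hV
      · rintro _ ⟨v, hv, rfl⟩
        exact hVt hv
    · rintro ⟨V, hV, hVt⟩
      exact Filter.mem_of_superset (hV.mem_nhds V.zero_mem) hVt
  · intro V hV
    have := hX.artinian (V.comap C.mkQ) (hV.preimage hcont)
    refine isArtinian_of_surjective (X ⧸ V.comap C.mkQ)
      (Submodule.mapQ (V.comap C.mkQ) V C.mkQ le_rfl) ?_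
    intro y
    obtain ⟨y, rfl⟩ := V.mkQ_surjective y
    obtain ⟨x, rfl⟩ := C.mkQ_surjective y
    exact ⟨Submodule.Quotient.mk x, rfl⟩
  · intro ι a D hD hfin
    choose b hb using fun i => C.mkQ_surjective (a i)
    obtain ⟨x, hx⟩ := hX.exists_common b (fun i => (D i).comap C.mkQ)
      (fun i => (hD i).preimage hcont) (by
        intro s
        obtain ⟨y, hy⟩ := hfin s
        obtain ⟨x, rfl⟩ := C.mkQ_surjective y
        refine ⟨x, fun i hi => ?_⟩
        rw [Submodule.mem_comap, map_sub, hb]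
        exact hy i hi)
    refine ⟨C.mkQ x, fun i => ?_⟩
    rw [← hb, ← map_sub]
    exact hx i

end IsLinearlyCompactMod

lemma map_mkQ_le_algSocle [IsTopologicalAddGroup X] {W : Submodule R X}
    (hW : IsSemisimpleTop R W) {V : Submodule R X} (hV : IsOpen (V : Set X)) :
    W.map V.mkQ ≤ algSocle R (X ⧸ V) := by
  have hr : W.map V.mkQ = LinearMap.range (V.mkQ ∘ₗ W.subtype) := by
    rw [LinearMap.range_comp, Submodule.range_subtype]
  rw [hr]
  refine le_algSocle ?_
  set f := V.mkQ ∘ₗ W.subtype with hf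
  set g := f.rangeRestrict with hg
  have hgs : Function.Surjective g := f.surjective_rangeRestrict
  have hopen : IsOpen ((LinearMap.ker g : Submodule R W) : Set W) := by
    have : LinearMap.ker g = V.comap W.subtype := by
      rw [hg, LinearMap.ker_rangeRestrict, hf, LinearMap.ker_comp, Submodule.ker_mkQ]
    rw [this]
    exact hV.preimage continuous_subtype_val
  have : IsTopologicalAddGroup W := inferInstance
  suffices h : ComplementedLattice (Submodule R (LinearMap.range f)) from { toComplementedLattice := h }
  refine ⟨fun P => ?_⟩
  obtain ⟨Q, -, hQ⟩ := hW (P.comap g) (isClosed_of_isOpen_submodule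
    (isOpen_of_isOpen_le hopen (LinearMap.ker_le_comap g)))
  refine ⟨Q.map g, ?_, ?_⟩
  · rw [Submodule.disjoint_def]
    rintro _ hx ⟨q, hq, rfl⟩
    have := (Submodule.disjoint_def.1 hQ.disjoint) q hx hq
    rw [this, map_zero]
  · rw [codisjoint_iff, ← Submodule.map_comap_eq_of_surjective hgs P, ← Submodule.map_sup,
      hQ.sup_eq_top, Submodule.map_top, LinearMap.range_eq_top.2 hgs]

namespace IsLinearlyCompactMod

lemma isSemisimpleTop (hX : IsLinearlyCompactMod R X) {W : Submodule R X}
    (hWc : IsClosed (W : Set X))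
    (hW : ∀ V : Submodule R X, IsOpen (V : Set X) → W.map V.mkQ ≤ algSocle R (X ⧸ V)) :
    IsSemisimpleTop R W := by
  have := hX.addGroup
  have := hX.t2
  intro P hP
  set P₀ : Submodule R X := P.map W.subtype with hP₀
  have hP₀c : IsClosed (P₀ : Set X) := by
    rw [hP₀, Submodule.map_coe]
    exact hWc.isClosedEmbedding_subtypeVal.isClosedMap _ hP
  have hP₀W : P₀ ≤ W := Submodule.map_subtype_le W P
  obtain ⟨Y, hYW, hY⟩ := zorn_le_nonempty₀ (α := (Submodule R X)ᵒᵈ)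
    {Y | IsClosed ((OrderDual.ofDual Y : Submodule R X) : Set X) ∧
      OrderDual.ofDual Y ≤ W ∧ W ≤ P₀ ⊔ OrderDual.ofDual Y} (by
    intro c hc hchain Y₀ hY₀
    let D : c → Submodule R X := fun Y => OrderDual.ofDual Y.1
    have : Nonempty c := ⟨⟨Y₀, hY₀⟩⟩
    refine ⟨OrderDual.toDual (⨅ i, D i), ⟨?_, ?_, ?_⟩, fun Y hY => ?_⟩
    · rw [OrderDual.ofDual_toDual, Submodule.coe_iInf]
      exact isClosed_iInter fun i => (hc i.2).1
    · exact (iInf_le D ⟨Y₀, hY₀⟩).trans (hc hY₀).2.1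
    · intro w hw
      refine hX.mem_sup_iInf (fun i => (hc i.2).1) ?_ hP₀c fun i => (hc i.2).2.2 hw
      intro i j
      rcases hchain.total i.2 j.2 with h | h
      · exact ⟨j, h, le_rfl⟩
      · exact ⟨i, le_rfl, h⟩
    · exact iInf_le D ⟨Y, hY⟩) (OrderDual.toDual W) ⟨hWc, le_rfl, le_sup_right⟩
  obtain ⟨⟨hYc, hYW', hYsup⟩, hmin⟩ := hY
  have hmin' : ∀ Z : Submodule R X, IsClosed (Z : Set X) → Z ≤ OrderDual.ofDual Y →
      W ≤ P₀ ⊔ Z → OrderDual.ofDual Y ≤ Z := fun Z h1 h2 h3 =>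
    hmin (y := OrderDual.toDual Z) ⟨h1, h2.trans hYW', h3⟩ h2
  generalize OrderDual.ofDual Y = Y' at hYc hYW' hYsup hmin'
  refine ⟨Y'.comap W.subtype, hYc.preimage continuous_subtype_val, ?_, ?_⟩
  · rw [Submodule.disjoint_def]
    intro x hxP hxY
    have hxP₀ : (x : X) ∈ P₀ := ⟨x, hxP, rfl⟩
    have hxY' : (x : X) ∈ Y' := hxY
    suffices h : (x : X) ∈ (⊥ : Submodule R X) by simpa using h
    refine hX.mem_of_forall_isOpen (by simp) fun V hV => ⟨0, zero_mem _, ?_⟩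
    rw [zero_sub, neg_mem_iff]
    have hss : IsSemisimpleModule R (Y'.map V.mkQ) :=
      isSemisimpleModule_of_le_algSocle ((Submodule.map_mono hYW').trans (hW V hV))
    obtain ⟨Q, hQ⟩ := hss.exists_isCompl
      (((P₀ ⊓ Y').map V.mkQ).comap (Y'.map V.mkQ).subtype)
    let Q₀ : Submodule R (X ⧸ V) := Q.map (Y'.map V.mkQ).subtype
    let Z : Submodule R X := Y' ⊓ Q₀.comap V.mkQ
    have hZY : Y' ≤ Z := by
      refine hmin' Z (hYc.inter (isClosed_of_isOpen_submodule (isOpen_comap_mkQ hV Q₀))) inf_le_left ?_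
      refine hYsup.trans (sup_le le_sup_left fun y hy => ?_)
      have hy' : (⟨V.mkQ y, y, hy, rfl⟩ : Y'.map V.mkQ) ∈
          (((P₀ ⊓ Y').map V.mkQ).comap (Y'.map V.mkQ).subtype) ⊔ Q := by
        rw [hQ.sup_eq_top]; trivial
      obtain ⟨a, ⟨b, ⟨hbP, hbY⟩, hba⟩, q, hq, haq⟩ := Submodule.mem_sup.1 hy'
      refine Submodule.mem_sup.2 ⟨b, hbP, y - b, ⟨sub_mem hy hbY, q, hq, ?_⟩, by abel⟩
      have := congrArg Subtype.val haq
      rw [map_sub, hba]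
      exact eq_sub_of_add_eq' this
    obtain ⟨q, hq, hqx⟩ := (hZY hxY').2
    have hq0 := (Submodule.disjoint_def.1 hQ.disjoint) q
      ⟨x, ⟨hxP₀, hxY'⟩, hqx.symm⟩ hq
    rw [hq0, map_zero] at hqx
    exact (Submodule.Quotient.mk_eq_zero V).1 hqx.symm
  · rw [codisjoint_iff, eq_top_iff]
    rintro ⟨w, hw⟩ -
    obtain ⟨p, ⟨p', hp', rfl⟩, y, hy, hpy⟩ := Submodule.mem_sup.1 (hYsup hw)
    exact Submodule.mem_sup.2 ⟨p', hp', ⟨y, hYW' hy⟩, hy, Subtype.ext hpy⟩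

lemma socle_eq (hX : IsLinearlyCompactMod R X) :
    socle R X = ⨅ V : {V : Submodule R X // IsOpen (V : Set X)},
      (algSocle R (X ⧸ V.1)).comap V.1.mkQ := by
  have := hX.addGroup
  apply le_antisymm
  · refine sSup_le fun W hW => le_iInf fun V => ?_
    exact Submodule.map_le_iff_le_comap.1 (map_mkQ_le_algSocle hW.2 V.2)
  · set S := ⨅ V : {V : Submodule R X // IsOpen (V : Set X)},
      (algSocle R (X ⧸ V.1)).comap V.1.mkQ with hS
    have hSc : IsClosed (S : Set X) := by
      rw [hS, Submodule.coe_iInf]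
      refine isClosed_iInter fun V => isClosed_of_isOpen_submodule (isOpen_comap_mkQ V.2 _)
    refine le_sSup ⟨hSc, hX.isSemisimpleTop hSc fun V hV => ?_⟩
    rw [Submodule.map_le_iff_le_comap, hS]
    exact iInf_le (fun V : {V : Submodule R X // IsOpen (V : Set X)} =>
      (algSocle R (X ⧸ V.1)).comap V.1.mkQ) ⟨V, hV⟩

lemma mem_socle_iff (hX : IsLinearlyCompactMod R X) {x : X} :
    x ∈ socle R X ↔
      ∀ V : Submodule R X, IsOpen (V : Set X) → V.mkQ x ∈ algSocle R (X ⧸ V) := by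
  simp [hX.socle_eq]

lemma isClosed_socle (hX : IsLinearlyCompactMod R X) : IsClosed (socle R X : Set X) := by
  have := hX.addGroup
  rw [hX.socle_eq, Submodule.coe_iInf]
  refine isClosed_iInter fun V => isClosed_of_isOpen_submodule (isOpen_comap_mkQ V.2 _)

lemma mkQ_mem_socle_iff (hX : IsLinearlyCompactMod R X) {C : Submodule R X}
    (hC : IsClosed (C : Set X)) {x : X} :
    C.mkQ x ∈ socle R (X ⧸ C) ↔
      ∀ V : Submodule R X, IsOpen (V : Set X) → C ≤ V → V.mkQ x ∈ algSocle R (X ⧸ V) := by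
  have := hX.addGroup
  rw [(hX.quotient hC).mem_socle_iff]
  constructor
  · intro h V hV hCV
    have h1 := h (V.map C.mkQ) (by rw [Submodule.map_coe]; exact C.isOpenMap_mkQ _ hV)
    exact map_mem_algSocle (Submodule.quotientQuotientEquivQuotient C V hCV).toLinearMap h1
  · intro h V hV
    refine map_mem_algSocle (Submodule.mapQ (V.comap C.mkQ) V C.mkQ le_rfl)
      (h (V.comap C.mkQ) (hV.preimage C.isOpenQuotientMap_mkQ.continuous) ?_)
    intro c hc
    rw [Submodule.mem_comap, Submodule.mkQ_apply, (Submodule.Quotient.mk_eq_zero C).2 hc]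
    exact zero_mem _

lemma exists_le_sup_iInf (hX : IsLinearlyCompactMod R X) {ι : Type} [Nonempty ι]
    {D : ι → Submodule R X} (hD : ∀ i, IsClosed (D i : Set X)) (hdir : Directed (· ≥ ·) D)
    {V : Submodule R X} (hV : IsOpen (V : Set X)) : ∃ i, D i ≤ V ⊔ ⨅ i, D i := by
  have := hX.addGroup
  have := hX.artinian V hV
  obtain ⟨_, ⟨i, rfl⟩, hi⟩ := IsArtinian.set_has_minimal
    (Set.range fun i => (D i).map V.mkQ) (Set.range_nonempty _)
  refine ⟨i, fun x hx => hX.mem_sup_iInf hD hdir (isClosed_of_isOpen_submodule hV) fun j => ?_⟩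
  obtain ⟨l, hli, hlj⟩ := hdir i j
  have hle : (D i).map V.mkQ ≤ (D l).map V.mkQ := by
    by_contra hcon
    exact hi _ ⟨l, rfl⟩ (lt_of_le_not_ge (Submodule.map_mono hli) hcon)
  obtain ⟨d, hd, hdx⟩ := hle ⟨x, hx, rfl⟩
  refine Submodule.mem_sup.2 ⟨x - d, ?_, d, hlj hd, by abel⟩
  exact (Submodule.Quotient.eq V).1 hdx.symm

end IsLinearlyCompactMod

end LinearlyCompact

section PseudocompactIsLinearlyCompact

variable {F : Type} [Field F] {A : Type} [Ring A] [Algebra F A] [TopologicalSpace A]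
  {X : Type} [AddCommGroup X] [Module F X] [Module A X] [IsScalarTower F A X]
  [TopologicalSpace X]

namespace IsPseudocompactMod

lemma finiteDimensional_quotient (hX : IsPseudocompactMod F A X) {V : Submodule A X}
    (hV : IsOpen (V : Set X)) : FiniteDimensional F (X ⧸ V) := by
  obtain ⟨W, ⟨-, hWfin⟩, hWV⟩ := hX.basis.mem_iff.1 (hV.mem_nhds V.zero_mem)
  have : FiniteDimensional F (X ⧸ W) := hWfin
  refine Module.Finite.of_surjective
    ((Submodule.mapQ W V LinearMap.id hWV).restrictScalars F) ?_
  intro y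
  obtain ⟨x, rfl⟩ := V.mkQ_surjective y
  exact ⟨W.mkQ x, rfl⟩

lemma exists_common (hX : IsPseudocompactMod F A X) {ι : Type} (a : ι → X)
    (C : ι → Submodule A X) (hC : ∀ i, IsClosed (C i : Set X))
    (hfin : ∀ s : Finset ι, ∃ x, ∀ i ∈ s, x - a i ∈ C i) :
    ∃ x, ∀ i, x - a i ∈ C i := by
  have := hX.addGroup
  obtain ⟨M, hM, hmax⟩ := zorn_subset_nonempty
    {M : Set (X × Submodule A X) |
      ∀ s : Finset (X × Submodule A X), ↑s ⊆ M → ∃ x, ∀ p ∈ s, x - p.1 ∈ p.2} (by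
    intro c hc hchain hne
    refine ⟨⋃₀ c, fun s hs => ?_, fun t ht => Set.subset_sUnion_of_mem ht⟩
    obtain ⟨t, ht, hst⟩ := DirectedOn.exists_mem_subset_of_finset_subset_biUnion
      (f := id) hne hchain.directedOn (by simpa [Set.sUnion_eq_biUnion] using hs)
    exact hc ht s hst) (Set.range fun i => (a i, C i)) (by
    intro s hs
    rw [← Set.image_univ] at hs
    obtain ⟨t, -, rfl⟩ := Finset.subset_set_image_iff.1 hs
    obtain ⟨x, hx⟩ := hfin t
    refine ⟨x, fun p hp => ?_⟩
    obtain ⟨i, hi, rfl⟩ := Finset.mem_image.1 hp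
    exact hx i hi)
  have hFIP := hmax.1
  have hcoset : ∀ V : Submodule A X, IsOpen (V : Set X) → ∃ b, (b, V) ∈ M := by
    intro V hV
    have := hX.finiteDimensional_quotient hV
    have : IsArtinian A (X ⧸ V) := isArtinian_of_tower F inferInstance
    let D : Finset (X × Submodule A X) → Submodule A X := fun s => s.inf Prod.snd
    obtain ⟨_, ⟨t₀, ht₀, rfl⟩, hmin⟩ := IsArtinian.set_has_minimal
      ((fun t => (D t).map V.mkQ) '' {t | (t : Set (X × Submodule A X)) ⊆ M})
      ⟨_, ∅, by simp, rfl⟩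
    obtain ⟨b, hb⟩ := hFIP t₀ ht₀
    refine ⟨b, ?_⟩
    suffices h : insert (b, V) M ⊆ M from h (Set.mem_insert _ _)
    refine hmax.2 (fun s hs => ?_) (Set.subset_insert _ _)
    set s' := s.erase (b, V) with hs'
    have hs'M : (s' : Set (X × Submodule A X)) ⊆ M := by
      intro p hp
      rw [hs', Finset.coe_erase] at hp
      exact (hs hp.1).resolve_left hp.2
    have htM : ((s' ∪ t₀ : Finset _) : Set (X × Submodule A X)) ⊆ M := by
      rw [Finset.coe_union]
      exact Set.union_subset hs'M ht₀
    obtain ⟨y, hy⟩ := hFIP _ htM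
    have hDle : D (s' ∪ t₀) ≤ D t₀ := Finset.inf_mono Finset.subset_union_right
    have hyb : y - b ∈ D t₀ := by
      refine (Submodule.mem_finsetInf).2 fun p hp => ?_
      have := sub_mem (hy p (Finset.mem_union_right _ hp)) (hb p hp)
      simpa using this
    have hle : (D t₀).map V.mkQ ≤ (D (s' ∪ t₀)).map V.mkQ := by
      by_contra hcon
      exact hmin _ ⟨_, htM, rfl⟩ (lt_of_le_not_ge (Submodule.map_mono hDle) hcon)
    obtain ⟨d, hd, hdy⟩ := hle ⟨_, hyb, rfl⟩
    refine ⟨y - d, fun p hp => ?_⟩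
    by_cases hpb : p = (b, V)
    · subst hpb
      have := (Submodule.Quotient.eq V).1 hdy.symm
      have h2 : y - d - b = y - b - d := by abel
      rw [h2]
      exact this
    · have hp' : p ∈ s' ∪ t₀ := Finset.mem_union_left _ (Finset.mem_erase.2 ⟨hpb, hp⟩)
      have h1 : d ∈ p.2 := (Submodule.mem_finsetInf).1 hd p hp'
      have h2 : y - d - p.1 = y - p.1 - d := by abel
      rw [h2]
      exact sub_mem (hy p hp') h1
  choose! b hb using hcoset
  obtain ⟨x, hx⟩ := hX.complete (fun V => Submodule.Quotient.mk (b V.1)) (by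
    intro V W hVW
    have hle : V.1 ≤ W.1.comap LinearMap.id := hVW
    rw [mapQ', dif_pos hle, Submodule.mapQ_apply, LinearMap.id_apply, Submodule.Quotient.eq]
    obtain ⟨y, hy⟩ := hFIP {(b V.1, V.1), (b W.1, W.1)} (by
      simp [Set.insert_subset_iff, hb V.1 V.2.1, hb W.1 W.2.1])
    have h1 := hVW (hy (b V.1, V.1) (by simp))
    have h2 := hy (b W.1, W.1) (by simp)
    simpa using sub_mem h2 h1)
  refine ⟨x, fun i => ?_⟩
  rw [← SetLike.mem_coe, ← (hC i).closure_eq, mem_closure_iff_nhds]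
  intro t ht
  have ht' : (fun y => x - a i + y) ⁻¹' t ∈ nhds (0 : X) :=
    (continuous_const_add (x - a i)).continuousAt.preimage_mem_nhds (by simpa using ht)
  obtain ⟨V, hV, hVt⟩ := hX.basis.mem_iff.1 ht'
  obtain ⟨y, hy⟩ := hFIP {(b V, V), (a i, C i)} (by
    simp [Set.insert_subset_iff, hb V hV.1, hM ⟨i, rfl⟩])
  have h1 := hy (b V, V) (by simp)
  have h2 := hy (a i, C i) (by simp)
  have h3 : x - b V ∈ V := (Submodule.Quotient.eq V).1 (hx ⟨V, hV⟩).symm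
  have h4 : y - x ∈ V := by simpa using sub_mem h1 h3
  refine ⟨y - a i, ?_, h2⟩
  have h5 := hVt h4
  rw [Set.mem_preimage] at h5
  convert h5 using 1
  abel

lemma isLinearlyCompactMod (hX : IsPseudocompactMod F A X) : IsLinearlyCompactMod A X where
  t2 := hX.t2
  addGroup := hX.addGroup
  basis := hX.basis.to_hasBasis (fun V hV => ⟨V, hV.1, subset_rfl⟩) fun V hV => by
    obtain ⟨W, hW, hWV⟩ := hX.basis.mem_iff.1 (hV.mem_nhds V.zero_mem)
    exact ⟨W, hW, hWV⟩
  artinian V hV := by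
    have := hX.finiteDimensional_quotient hV
    exact isArtinian_of_tower F inferInstance
  exists_common := hX.exists_common

end IsPseudocompactMod

end PseudocompactIsLinearlyCompact

lemma nonempty_quotient_equiv {R X Y : Type} [Ring R] [AddCommGroup X] [Module R X]
    [TopologicalSpace X] [IsTopologicalAddGroup X] [AddCommGroup Y] [Module R Y]
    [TopologicalSpace Y] (f : X →ₗ[R] Y) (hcont : Continuous f) (hopen : IsOpenMap f)
    (hsurj : Function.Surjective f) {S : Submodule R X} (hker : LinearMap.ker f = S) :
    Nonempty ((X ⧸ S) ≃L[R] Y) := by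
  subst hker
  let e := f.quotKerEquivOfSurjective hsurj
  have he : ⇑e ∘ (LinearMap.ker f).mkQ = f := rfl
  have hq := (LinearMap.ker f).isOpenQuotientMap_mkQ
  refine ⟨e, hq.continuous_comp_iff.1 hcont, continuous_def.2 fun s hs => ?_⟩
  have hs' : ⇑e.symm ⁻¹' s = f '' ((LinearMap.ker f).mkQ ⁻¹' s) := by
    rw [← he, Set.image_comp, Set.image_preimage_eq _ hq.surjective]
    exact (e.toEquiv.image_eq_preimage_symm s).symm
  exact hs' ▸ hopen _ (hs.preimage hq.continuous)

/-- A linearly compact module maps onto the limit of any downward directed system of its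
quotients by closed submodules, and the induced bijection is a homeomorphism. -/
lemma IsLinearlyCompactMod.nonempty_quotient_equiv_compatLim {R X : Type} [Ring R]
    [AddCommGroup X] [Module R X] [TopologicalSpace X] (hX : IsLinearlyCompactMod R X)
    {ι : Type} [Preorder ι] [Nonempty ι] [IsDirectedOrder ιᵒᵈ] (T : ι → Type)
    [∀ i, AddCommGroup (T i)] [∀ i, Module R (T i)] [∀ i, TopologicalSpace (T i)]
    [∀ i, IsTopologicalAddGroup (T i)] (t : ∀ i j, i ≤ j → (T i →ₗ[R] T j))
    (f : ∀ i, X →ₗ[R] T i) (hf : ∀ i, IsOpenQuotientMap (f i))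
    (htf : ∀ i j (h : i ≤ j) x, t i j h (f i x) = f j x)
    (hker : ∀ i, IsClosed (LinearMap.ker (f i) : Set X)) {S : Submodule R X}
    (hS : S = ⨅ i, LinearMap.ker (f i)) :
    Nonempty ((X ⧸ S) ≃L[R] compatLim T t) := by
  have := hX.addGroup
  have hdir : Directed (· ≥ ·) fun i => LinearMap.ker (f i) := by
    intro i j
    obtain ⟨l, hi, hj⟩ := exists_ge_ge (OrderDual.toDual i) (OrderDual.toDual j)
    have hmono : ∀ m (h : OrderDual.ofDual l ≤ m),
        LinearMap.ker (f (OrderDual.ofDual l)) ≤ LinearMap.ker (f m) := fun m h x hx => by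
      rw [LinearMap.mem_ker] at hx ⊢
      rw [← htf _ m h, hx, map_zero]
    exact ⟨OrderDual.ofDual l, hmono i hi, hmono j hj⟩
  let F : X →ₗ[R] compatLim T t := (LinearMap.pi f).codRestrict (compatLim T t)
    fun x i j h => htf i j h x
  have hF : ∀ x i, (F x).1 i = f i x := fun _ _ => rfl
  have hkerF : LinearMap.ker F = S := by
    ext x
    rw [hS, LinearMap.mem_ker, Submodule.mem_iInf, Subtype.ext_iff, funext_iff]
    rfl
  have hcont : Continuous F :=
    Continuous.subtype_mk (continuous_pi fun i => (hf i).continuous) _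
  have hsurj : Function.Surjective F := by
    intro c
    choose a ha using fun i => (hf i).surjective (c.1 i)
    obtain ⟨x, hx⟩ := hX.exists_common a (fun i => LinearMap.ker (f i)) hker (by
      intro s
      obtain ⟨m, hm⟩ := (s.image OrderDual.toDual).exists_le
      refine ⟨a (OrderDual.ofDual m), fun i hi => ?_⟩
      have hmi : OrderDual.ofDual m ≤ i := hm _ (Finset.mem_image_of_mem _ hi)
      rw [LinearMap.sub_mem_ker_iff, ← htf _ i hmi, ha, ha]
      exact c.2 _ i hmi)
    refine ⟨x, Subtype.ext (funext fun i => ?_)⟩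
    rw [hF, ← ha, ← LinearMap.sub_mem_ker_iff]
    exact hx i
  have hopen : IsOpenMap F := by
    refine (IsTopologicalAddGroup.isOpenMap_iff_nhds_zero (f := F)).2 ?_
    intro s hs
    obtain ⟨V, hV, hVs⟩ := hX.basis.mem_iff.1 (Filter.mem_map.1 hs)
    obtain ⟨i, hi⟩ := hX.exists_le_sup_iInf hker hdir hV
    rw [← hS] at hi
    have hnhds : (fun c : compatLim T t => c.1 i) ⁻¹' (f i '' V) ∈
        nhds (0 : compatLim T t) := by
      refine (((hf i).isOpenMap _ hV).preimage
        ((continuous_apply i).comp continuous_subtype_val)).mem_nhds ?_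
      exact ⟨0, V.zero_mem, map_zero _⟩
    refine Filter.mem_of_superset hnhds ?_
    rintro c ⟨v, hv, hvc⟩
    obtain ⟨u, rfl⟩ := hsurj c
    have huv : u - v ∈ LinearMap.ker (f i) := LinearMap.sub_mem_ker_iff.2 hvc.symm
    obtain ⟨w, hw, z, hz, hwz⟩ := Submodule.mem_sup.1 (hi huv)
    rw [← hkerF] at hz
    have hu : F u = F (v + w) := by
      rw [← LinearMap.sub_mem_ker_iff]
      convert hz using 1
      rw [← sub_sub, ← hwz]
      abel
    rw [hu]
    exact hVs (V.add_mem hv hw)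
  exact nonempty_quotient_equiv F hcont hopen hsurj hkerF

section CoinvariantTower

variable {k : Type} [Field k] {G : Type} [Group G] [TopologicalSpace G]

lemma continuous_ofG [IsTopologicalGroup G] : Continuous (ofG k G) := by
  refine Continuous.subtype_mk (continuous_pi fun N => ?_) _
  have : DiscreteTopology (G ⧸ N.toSubgroup) :=
    inferInstanceAs (DiscreteTopology (G ⧸ N.toOpenSubgroup.toSubgroup))
  exact (continuous_of_discreteTopology
    (f := fun q : G ⧸ N.toSubgroup => (MonoidAlgebra.single q 1 : MonoidAlgebra k _))).comp
    continuous_quotient_mk'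

variable {U : Type} [AddCommGroup U] [Module (CGA k G) U] [TopologicalSpace U]

lemma isClosed_coinvKer (N : OpenNormalSubgroup G) :
    IsClosed (coinvKer k G N U : Set U) := by
  rw [coinvKer, Submodule.coe_sInf]
  exact isClosed_biInter fun W hW => hW.1

lemma exists_coinvKer_le [IsTopologicalGroup G] [CompactSpace G] [TotallyDisconnectedSpace G]
    [Module k U] [IsScalarTower k (CGA k G) U] (hU : IsPseudocompactMod k (CGA k G) U)
    {V : Submodule (CGA k G) U} (hV : IsOpen (V : Set U)) :
    ∃ N : OpenNormalSubgroup G, coinvKer k G N U ≤ V := by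
  have := hU.addGroup
  have := hU.contSMul
  have := hU.finiteDimensional_quotient hV
  obtain ⟨s, hs⟩ := Module.finite_def.1 this
  choose b hb using V.mkQ_surjective
  have hopen : IsOpen (⋂ y ∈ s, {g : G | ofG k G g • b y - b y ∈ V}) :=
    isOpen_biInter_finset fun y _ => hV.preimage
      ((continuous_ofG.smul continuous_const).sub continuous_const)
  obtain ⟨N, hN⟩ := ProfiniteGrp.exist_openNormalSubgroup_sub_open_nhds_of_one hopen (by simp)
  refine ⟨N, sInf_le ⟨isClosed_of_isOpen_submodule hV, fun n hn u => ?_⟩⟩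
  have hn' : ∀ y ∈ s, ofG k G n • b y - b y ∈ V := by simpa using hN hn
  let T : U →ₗ[k] U := Algebra.lsmul k k U (ofG k G n) - LinearMap.id
  have hT : ∀ x, T x = ofG k G n • x - x := fun x => rfl
  have htop : ((V.restrictScalars k).comap T).map (V.mkQ.restrictScalars k) = ⊤ := by
    rw [eq_top_iff, ← hs, Submodule.span_le]
    intro y hy
    exact ⟨b y, hn' y hy, hb y⟩
  obtain ⟨x, hx, hxu⟩ : V.mkQ u ∈ ((V.restrictScalars k).comap T).map
      (V.mkQ.restrictScalars k) := by
    rw [htop]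
    trivial
  have hxu' : x - u ∈ V := (Submodule.Quotient.eq V).1 hxu
  have hx' : ofG k G n • x - x ∈ V := hx
  have := add_mem (sub_mem hx' (V.smul_mem (ofG k G n) hxu')) hxu'
  rw [smul_sub] at this
  convert this using 1
  abel

variable (k) (U) in
/-- The preimage in `U` of the socle of the coinvariants `U_N`. -/
def socleLift (N : OpenNormalSubgroup G) : Submodule (CGA k G) U :=
  (socle (CGA k G) (coinv k G N U)).comap (phi k G N U)

lemma mem_socleLift_iff (hU : IsLinearlyCompactMod (CGA k G) U) {N : OpenNormalSubgroup G}
    {x : U} : x ∈ socleLift k U N ↔ ∀ V : Submodule (CGA k G) U, IsOpen (V : Set U) →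
      coinvKer k G N U ≤ V → V.mkQ x ∈ algSocle (CGA k G) (U ⧸ V) :=
  hU.mkQ_mem_socle_iff (isClosed_coinvKer N)

lemma socleLift_mono (hU : IsLinearlyCompactMod (CGA k G) U) {N M : OpenNormalSubgroup G}
    (h : N ≤ M) : socleLift k U N ≤ socleLift k U M := fun _ hx =>
  (mem_socleLift_iff hU).2 fun V hV hMV =>
    (mem_socleLift_iff hU).1 hx V hV ((coinvKer_mono h U).trans hMV)

lemma isClosed_socleLift (hU : IsLinearlyCompactMod (CGA k G) U) (N : OpenNormalSubgroup G) :
    IsClosed (socleLift k U N : Set U) :=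
  have := hU.addGroup
  (hU.quotient (isClosed_coinvKer N)).isClosed_socle.preimage
    (coinvKer k G N U).isOpenQuotientMap_mkQ.continuous

lemma socle_eq_iInf_socleLift [IsTopologicalGroup G] [CompactSpace G]
    [TotallyDisconnectedSpace G] [Module k U] [IsScalarTower k (CGA k G) U]
    (hU : IsPseudocompactMod k (CGA k G) U) :
    socle (CGA k G) U = ⨅ N : OpenNormalSubgroup G, socleLift k U N := by
  have hL := hU.isLinearlyCompactMod
  ext x
  simp only [hL.mem_socle_iff, Submodule.mem_iInf, mem_socleLift_iff hL]
  refine ⟨fun h N V hV _ => h V hV, fun h V hV => ?_⟩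
  obtain ⟨N, hN⟩ := exists_coinvKer_le hU hV
  exact h N V hV hN

/-- The projection from `U` to the quotient of `U_N` by its socle. -/
def toCoinvModSocle (k : Type) [Field k] {G : Type} [Group G] [TopologicalSpace G] (U : Type)
    [AddCommGroup U] [Module (CGA k G) U] [TopologicalSpace U] (N : OpenNormalSubgroup G) :
    U →ₗ[CGA k G] coinv k G N U ⧸ socle (CGA k G) (coinv k G N U) :=
  (socle (CGA k G) (coinv k G N U)).mkQ ∘ₗ phi k G N U

lemma ker_toCoinvModSocle (N : OpenNormalSubgroup G) :
    LinearMap.ker (toCoinvModSocle k U N) = socleLift k U N := by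
  rw [toCoinvModSocle, LinearMap.ker_comp, Submodule.ker_mkQ, socleLift]

lemma isOpenQuotientMap_toCoinvModSocle [IsTopologicalAddGroup U] (N : OpenNormalSubgroup G) :
    IsOpenQuotientMap (toCoinvModSocle k U N) :=
  (Submodule.isOpenQuotientMap_mkQ _).comp (Submodule.isOpenQuotientMap_mkQ _)

lemma mapQ'_toCoinvModSocle (hU : IsLinearlyCompactMod (CGA k G) U) {N M : OpenNormalSubgroup G}
    (h : N ≤ M) (x : U) :
    mapQ' (socle (CGA k G) (coinv k G N U)) (socle (CGA k G) (coinv k G M U))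
      (phiT k G N M h U) (toCoinvModSocle k U N x) = toCoinvModSocle k U M x := by
  have hle : socle (CGA k G) (coinv k G N U) ≤
      (socle (CGA k G) (coinv k G M U)).comap (phiT k G N M h U) := by
    intro y hy
    obtain ⟨y, rfl⟩ := (coinvKer k G N U).mkQ_surjective y
    exact socleLift_mono hU h hy
  rw [mapQ', dif_pos hle]
  rfl

end CoinvariantTower

/-- Lemma 2.15: For a pseudocompact `k⟦G⟧`-module `U`,
`U/Soc(U) ≅ lim_N U_N/Soc(U_N)` as topological `k⟦G⟧`-modules. -/
theorem quotient_by_socle_iso_limit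
    (p : ℕ) [Fact p.Prime] (k : Type) [Field k] [CharP k p]
    (G : Type) [Group G] [TopologicalSpace G] [IsTopologicalGroup G]
    [CompactSpace G] [TotallyDisconnectedSpace G] [T2Space G]
    (U : Type) [AddCommGroup U] [Module k U] [Module (CGA k G) U]
    [IsScalarTower k (CGA k G) U] [TopologicalSpace U]
    (hU : IsPseudocompactMod k (CGA k G) U) :
    Nonempty ((U ⧸ socle (CGA k G) U) ≃L[CGA k G]
      compatLim (fun N : OpenNormalSubgroup G =>
          (coinv k G N U) ⧸ socle (CGA k G) (coinv k G N U))
        (fun N M h => mapQ' (socle (CGA k G) (coinv k G N U))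
          (socle (CGA k G) (coinv k G M U)) (phiT k G N M h U))) := by
  have hL := hU.isLinearlyCompactMod
  have := hU.addGroup
  have : Nonempty (OpenNormalSubgroup G) :=
    ⟨(exists_coinvKer_le hU (V := ⊤) isOpen_univ).choose⟩
  refine hL.nonempty_quotient_equiv_compatLim _ _ (toCoinvModSocle k U)
    isOpenQuotientMap_toCoinvModSocle (fun N M h x => mapQ'_toCoinvModSocle hL h x) ?_ ?_
  · intro N
    rw [ker_toCoinvModSocle]
    exact isClosed_socleLift hL N
  · simp only [ker_toCoinvModSocle]
    exact socle_eq_iInf_socleLift hU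

end ProfiniteBlocks
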